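/- arXiv:2110.04672 — 2 statements merged into one kernel-verified Lean document; each statement's English description precedes it below -/
import Mathlib

section
/- Suppose the pentads P¹ = (c¹,κ_R¹,κ_L¹,b¹,a), P² = (c²,κ_R²,κ_L²,b²,a), P³ = (c³,κ_R³,κ_L³,b³,a) in PD̃(G) satisfy P¹ ∼_{PD(G)} P² with witness pair (m,σ) and P² ∼_{PD(G)} P³ with witness pair (l,σ′). Then P¹ ∼_{PD(G)} P³ with witness pair (l+m, σ·σ′·σ″), where σ″ ∈ C²(G,U(1)⊕U(1)) is defined by σ″(g,h) := (−1)^{(b²(g)−b¹(g)−m(g))·l(h)^{a(g)}}. -/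
noncomputable section

/-- `ℤ₂ ⊕ ℤ₂`, written additively with componentwise addition. -/
abbrev Z22 := ZMod 2 × ZMod 2

/-- `U(1) ⊕ U(1)`, written multiplicatively with componentwise multiplication,
where `U(1)` is the circle group. -/
abbrev U12 := Circle × Circle

/-- The `ℤ₂`-action on `ℤ₂ ⊕ ℤ₂`: `x^n = x` if `n = 0` and the swap of the two
components if `n = 1`. -/
def actZ (n : ZMod 2) (x : Z22) : Z22 := if n = 0 then x else (x.2, x.1)

/-- The `ℤ₂`-action on `U(1) ⊕ U(1)`: `x^n = x` if `n = 0` and the swap of the two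
components if `n = 1`. -/
def actU (n : ZMod 2) (x : U12) : U12 := if n = 0 then x else (x.2, x.1)

/-- The componentwise product `x·y` in the field `ℤ₂`. -/
def dotZ (x y : Z22) : Z22 := (x.1 * y.1, x.2 * y.2)

/-- `-1` as an element of the circle group. -/
def negOneC : Circle := ⟨-1, by simp [Submonoid.unitSphere]⟩

/-- `(−1)^x ∈ U(1) ⊕ U(1)` for `x ∈ ℤ₂ ⊕ ℤ₂`, componentwise. -/
def negPow (x : Z22) : U12 := (negOneC ^ x.1.val, negOneC ^ x.2.val)

variable {G : Type*} [Group G]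

/-- First twisted coboundary, for `ℤ₂ ⊕ ℤ₂`-valued cochains. -/
def d1Z (a : G → ZMod 2) (x : G → Z22) (g h : G) : Z22 :=
  actZ (a g) (x h) + x g - x (g * h)

/-- Second twisted coboundary, for `ℤ₂ ⊕ ℤ₂`-valued cochains. -/
def d2Z (a : G → ZMod 2) (y : G → G → Z22) (g h k : G) : Z22 :=
  actZ (a g) (y h k) + y g (h * k) - y (g * h) k - y g h

/-- Second twisted coboundary, for `U(1) ⊕ U(1)`-valued cochains. -/
def d2U (a : G → ZMod 2) (y : G → G → U12) (g h k : G) : U12 :=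
  actU (a g) (y h k) * y g (h * k) * (y (g * h) k)⁻¹ * (y g h)⁻¹

/-- Third twisted coboundary, for `U(1) ⊕ U(1)`-valued cochains. -/
def d3U (a : G → ZMod 2) (z : G → G → G → U12) (g h k f : G) : U12 :=
  actU (a g) (z h k f) * z g (h * k) f * z g h k *
    (z (g * h) k f)⁻¹ * (z g h (k * f))⁻¹

/-- The data `(c, κ_R, κ_L, b)` of a pentad with twist `a` kept separate. -/
structure PentadData (G : Type*) where
  c : G → G → G → U12
  kR : G → G → Z22
  kL : G → G → Z22
  b : G → Z22

/-- `(c, κ_R, κ_L, b, a) ∈ PD̃(G)`: `a` is a group homomorphism into `ℤ₂`,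
`d¹ₐ b = κ_L + κ_R`, `d²ₐ κ_R = 0`, `d²ₐ κ_L = 0` and
`d³ₐ c(g,h,k,f) = (−1)^{κ_L(g,h)·κ_R(k,f)^{a(gh)}}`. -/
def IsPentad (a : G → ZMod 2) (P : PentadData G) : Prop :=
  (∀ g h : G, a (g * h) = a g + a h) ∧
  (∀ g h : G, d1Z a P.b g h = P.kL g h + P.kR g h) ∧
  (∀ g h k : G, d2Z a P.kR g h k = 0) ∧
  (∀ g h k : G, d2Z a P.kL g h k = 0) ∧
  (∀ g h k f : G, d3U a P.c g h k f =
    negPow (dotZ (P.kL g h) (actZ (a (g * h)) (P.kR k f))))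

/-- `P ∼_{PD(G)} Q` with witness pair `(m, σ)`. -/
def RelW (a : G → ZMod 2) (P Q : PentadData G) (m : G → Z22)
    (σ : G → G → U12) : Prop :=
  (∀ g h : G, Q.kR g h = d1Z a m g h + P.kR g h) ∧
  (∀ g h : G, Q.kL g h =
    d1Z a Q.b g h - d1Z a P.b g h - d1Z a m g h + P.kL g h) ∧
  (∀ g h k : G, Q.c g h k =
    negPow (dotZ (P.kL g h) (actZ (a (g * h)) (m k))) *
    negPow (dotZ (Q.b g - P.b g - m g) (actZ (a g) (Q.kR h k))) *
    d2U a σ g h k * P.c g h k)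

theorem actZ_add (n : ZMod 2) (x y : Z22) : actZ n (x + y) = actZ n x + actZ n y := by
  unfold actZ; split_ifs <;> rfl

theorem actZ_sub (n : ZMod 2) (x y : Z22) : actZ n (x - y) = actZ n x - actZ n y := by
  unfold actZ; split_ifs <;> rfl

theorem actZ_dotZ (n : ZMod 2) (x y : Z22) :
    actZ n (dotZ x y) = dotZ (actZ n x) (actZ n y) := by
  unfold actZ; split_ifs <;> rfl

theorem actZ_actZ (m n : ZMod 2) (x : Z22) : actZ m (actZ n x) = actZ (m + n) x := by
  revert m n x; decide

theorem dotZ_eq_mul (x y : Z22) : dotZ x y = x * y := rfl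

theorem actU_mul (n : ZMod 2) (x y : U12) : actU n (x * y) = actU n x * actU n y := by
  unfold actU; split_ifs <;> rfl

theorem actU_negPow (n : ZMod 2) (x : Z22) : actU n (negPow x) = negPow (actZ n x) := by
  unfold actU actZ; split_ifs <;> rfl

theorem negOneC_mul_self : negOneC * negOneC = 1 := by
  ext
  exact neg_one_mul (-1 : ℂ) |>.trans (neg_neg 1)

theorem negOneC_pow_val_add (x y : ZMod 2) :
    negOneC ^ (x + y).val = negOneC ^ x.val * negOneC ^ y.val := by
  rw [ZMod.val_add, ← pow_add]
  exact (pow_eq_pow_mod _ (by rw [pow_two, negOneC_mul_self])).symm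

theorem negPow_add (x y : Z22) : negPow (x + y) = negPow x * negPow y :=
  Prod.ext (negOneC_pow_val_add _ _) (negOneC_pow_val_add _ _)

theorem negPow_inv (x : Z22) : (negPow x)⁻¹ = negPow x := by
  rw [inv_eq_iff_mul_eq_one, ← negPow_add, CharTwo.add_self_eq_zero]
  simp [negPow]

theorem d1Z_add {G : Type*} [Group G] (a : G → ZMod 2) (x y : G → Z22) (g h : G) :
    d1Z a (fun g => x g + y g) g h = d1Z a x g h + d1Z a y g h := by
  simp only [d1Z, actZ_add]; ring

theorem d1Z_sub {G : Type*} [Group G] (a : G → ZMod 2) (x y : G → Z22) (g h : G) :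
    d1Z a (fun g => x g - y g) g h = d1Z a x g h - d1Z a y g h := by
  simp only [d1Z, actZ_sub]; ring

theorem d2U_mul {G : Type*} [Group G] (a : G → ZMod 2) (x y : G → G → U12) (g h k : G) :
    d2U a (fun g h => x g h * y g h) g h k = d2U a x g h k * d2U a y g h k := by
  simp only [d2U, actU_mul, mul_inv]
  ac_rfl

/-- The Leibniz rule for the cup product of two `ℤ₂ ⊕ ℤ₂`-valued 1-cochains. -/
theorem d2U_negPow_cup {G : Type*} [Group G] (a : G → ZMod 2)
    (ha : ∀ g h, a (g * h) = a g + a h) (x y : G → Z22) (g h k : G) :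
    d2U a (fun g h => negPow (dotZ (x g) (actZ (a g) (y h)))) g h k =
      negPow (dotZ (d1Z a x g h) (actZ (a (g * h)) (y k))) *
        negPow (dotZ (x g) (actZ (a g) (d1Z a y h k))) := by
  simp only [d2U, actU_negPow, negPow_inv, ← negPow_add, actZ_dotZ, actZ_actZ, ← ha]
  congr 1
  simp only [d1Z, actZ_add, actZ_sub, actZ_actZ, ← ha, dotZ_eq_mul]
  linear_combination
    (actZ (a (g * h)) (y k) * x (g * h) + x g * actZ (a g) (y (h * k)) -
      x g * actZ (a (g * h)) (y k)) * (CharTwo.two_eq_zero : (2 : Z22) = 0)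

/-- **Transitivity with explicit witnesses.** If `P¹ ∼ P²` with witness `(m, σ)` and
`P² ∼ P³` with witness `(l, σ′)`, then `P¹ ∼ P³` with witness
`(l + m, σ·σ′·σ″)`, where `σ″(g,h) = (−1)^{(b²(g)−b¹(g)−m(g))·l(h)^{a(g)}}`. -/
theorem relW_trans (a : G → ZMod 2) (P1 P2 P3 : PentadData G)
    (h1 : IsPentad a P1) (h2 : IsPentad a P2) (h3 : IsPentad a P3)
    (m l : G → Z22) (σ σ' : G → G → U12)
    (h12 : RelW a P1 P2 m σ) (h23 : RelW a P2 P3 l σ') :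
    RelW a P1 P3 (fun g => l g + m g)
      (fun g h => σ g h * σ' g h *
        negPow (dotZ (P2.b g - P1.b g - m g) (actZ (a g) (l h)))) := by
  obtain ⟨hR, hL, hc⟩ := h12
  obtain ⟨hR', hL', hc'⟩ := h23
  refine ⟨fun g h => ?_, fun g h => ?_, fun g h k => ?_⟩
  · rw [hR', hR, d1Z_add, add_assoc]
  · rw [hL', hL, d1Z_add]
    ring
  · have hL'' : P2.kL g h = d1Z a (fun g => P2.b g - P1.b g - m g) g h + P1.kL g h := by
      rw [hL, d1Z_sub, d1Z_sub]
    have key : negPow (dotZ (P2.kL g h) (actZ (a (g * h)) (l k))) *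
          negPow (dotZ (P3.b g - P2.b g - l g) (actZ (a g) (P3.kR h k))) *
          (negPow (dotZ (P1.kL g h) (actZ (a (g * h)) (m k))) *
          negPow (dotZ (P2.b g - P1.b g - m g) (actZ (a g) (P2.kR h k)))) =
        negPow (dotZ (P1.kL g h) (actZ (a (g * h)) (l k + m k))) *
          negPow (dotZ (P3.b g - P1.b g - (l g + m g)) (actZ (a g) (P3.kR h k))) *
          d2U a (fun g h => negPow (dotZ (P2.b g - P1.b g - m g) (actZ (a g) (l h)))) g h k := by
      rw [d2U_negPow_cup a h1.1 (fun g => P2.b g - P1.b g - m g), hL'', hR' h k]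
      simp only [← negPow_add]
      congr 1
      simp only [dotZ_eq_mul, actZ_add]
      linear_combination
        (-((P2.b g - P1.b g - m g) * actZ (a g) (d1Z a l h k))) *
          (CharTwo.two_eq_zero : (2 : Z22) = 0)
    rw [hc', hc, d2U_mul a (fun g h => σ g h * σ' g h), d2U_mul]
    convert congrArg (· * (d2U a σ g h k * d2U a σ' g h k * P1.c g h k)) key using 1 <;>
      beta_reduce <;> ac_rfl
end
end

section
/- Let (c,κ_R,κ_L,b,a) ∈ PD̃(G) and define c̃ ∈ C³(G,U(1)⊕U(1)) by c̃(g,h,k) := (−1)^{b(g)·κ_R(h,k)^{a(g)}} · c(g,h,k). Then d³ₐc̃(g,h,k,f) = (−1)^{κ_R(g,h)·κ_R(k,f)^{a(gh)}} for all g,h,k,f ∈ G; consequently the pentad (c̃, κ_R, κ_R, 0, a) belongs to PD̃(G). -/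
noncomputable section

variable {G : Type*} [Group G]

/-- The modified 3-cochain `c̃(g,h,k) := (−1)^{b(g)·κ_R(h,k)^{a(g)}} · c(g,h,k)`. -/
def ctilde (a : G → ZMod 2) (P : PentadData G) (g h k : G) : U12 :=
  negPow (dotZ (P.b g) (actZ (a g) (P.kR h k))) * P.c g h k

theorem negOneC_pow_val_add_s5 (m n : ZMod 2) :
    negOneC ^ (m + n).val = negOneC ^ m.val * negOneC ^ n.val := by
  rw [ZMod.val_add, ← pow_add]
  exact (pow_eq_pow_mod _ (by rw [pow_two, negOneC_mul_self])).symm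

theorem actZ_zero (n : ZMod 2) : actZ n 0 = 0 := by
  unfold actZ
  split_ifs <;> rfl

theorem actZ_add_left (m n : ZMod 2) (x : Z22) : actZ (m + n) x = actZ m (actZ n x) := by
  revert m n x
  decide

theorem dotZ_add (x y z : Z22) : dotZ x (y + z) = dotZ x y + dotZ x z :=
  Prod.ext (mul_add _ _ _) (mul_add _ _ _)

theorem add_dotZ (x y z : Z22) : dotZ (x + y) z = dotZ x z + dotZ y z :=
  Prod.ext (add_mul _ _ _) (add_mul _ _ _)

/-- The twisted coboundary of `b ∪ κ` for a twisted 2-cocycle `κ` is `d¹ₐ b ∪ κ`. -/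
theorem cup_coboundary_eq (a : G → ZMod 2) (ha : ∀ g h, a (g * h) = a g + a h)
    (b : G → Z22) (κ : G → G → Z22) (hκ : ∀ g h k, d2Z a κ g h k = 0) (g h k f : G) :
    actZ (a g) (dotZ (b h) (actZ (a h) (κ k f))) + dotZ (b g) (actZ (a g) (κ (h * k) f)) +
        dotZ (b g) (actZ (a g) (κ h k)) + dotZ (b (g * h)) (actZ (a (g * h)) (κ k f)) +
        dotZ (b g) (actZ (a g) (κ h (k * f))) =
      dotZ (d1Z a b g h) (actZ (a (g * h)) (κ k f)) := by
  have hcocycle : actZ (a h) (κ k f) = κ (h * k) f + κ h k + κ h (k * f) := by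
    have := hκ h k f
    rw [d2Z, CharTwo.sub_eq_add, CharTwo.sub_eq_add] at this
    rw [← CharTwo.add_eq_zero, ← this]
    abel
  have hact : actZ (a (g * h)) (κ k f) = actZ (a g) (actZ (a h) (κ k f)) := by
    rw [ha, actZ_add_left]
  rw [actZ_dotZ, hact, d1Z, CharTwo.sub_eq_add, add_dotZ, add_dotZ]
  have hb : dotZ (b g) (actZ (a g) (actZ (a h) (κ k f))) =
      dotZ (b g) (actZ (a g) (κ (h * k) f)) + dotZ (b g) (actZ (a g) (κ h k)) +
        dotZ (b g) (actZ (a g) (κ h (k * f))) := by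
    rw [hcocycle, actZ_add, actZ_add, dotZ_add, dotZ_add]
  rw [hb]
  abel

theorem d3U_ctilde (a : G → ZMod 2) (P : PentadData G) (ha : ∀ g h, a (g * h) = a g + a h)
    (hκ : ∀ g h k, d2Z a P.kR g h k = 0) (g h k f : G) :
    d3U a (ctilde a P) g h k f =
      negPow (dotZ (d1Z a P.b g h) (actZ (a (g * h)) (P.kR k f))) * d3U a P.c g h k f := by
  rw [← cup_coboundary_eq a ha P.b P.kR hκ]
  simp only [d3U, ctilde, actU_mul, actU_negPow, mul_inv, negPow_inv, negPow_add]
  ac_rfl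

/-- **Lemma 2.3 (first part).** For `(c,κ_R,κ_L,b,a) ∈ PD̃(G)` and
`c̃(g,h,k) := (−1)^{b(g)·κ_R(h,k)^{a(g)}}·c(g,h,k)`, one has
`d³ₐc̃(g,h,k,f) = (−1)^{κ_R(g,h)·κ_R(k,f)^{a(gh)}}`, and consequently
`(c̃, κ_R, κ_R, 0, a) ∈ PD̃(G)`. -/
theorem ctilde_isPentad (a : G → ZMod 2) (P : PentadData G) (hP : IsPentad a P) :
    (∀ g h k f : G, d3U a (ctilde a P) g h k f =
      negPow (dotZ (P.kR g h) (actZ (a (g * h)) (P.kR k f)))) ∧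
    IsPentad a ⟨ctilde a P, P.kR, P.kR, 0⟩ := by
  obtain ⟨ha, hb, hR, -, hc⟩ := hP
  have hd : ∀ g h k f : G, d3U a (ctilde a P) g h k f =
      negPow (dotZ (P.kR g h) (actZ (a (g * h)) (P.kR k f))) := by
    intro g h k f
    rw [d3U_ctilde a P ha hR, hc, hb, ← negPow_add, ← add_dotZ, add_right_comm,
      CharTwo.add_self_eq_zero, zero_add]
  refine ⟨hd, ha, fun g h => ?_, hR, hR, hd⟩
  rw [CharTwo.add_self_eq_zero]
  simp [d1Z, actZ_zero]
end
end
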